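/- Let r ≥ 1, let A be a real positive definite symmetric r×r matrix, B ∈ ℝ^r, and q ∈ (0,1). Then ∑_{n,k ∈ (ℤ_{≥0})^r} q^{nᵀAn + (1/2)kᵀk + nᵀk + 2nᵀB + (1/2)(k₁+⋯+k_r)} / (∏_{i=1}^r (q)_{n_i}(q)_{k_i}) = ((q²;q²)_∞/(q;q)_∞)^r · ∑_{n ∈ (ℤ_{≥0})^r} q^{nᵀAn + 2nᵀB} / (∏_{i=1}^r (q²;q²)_{n_i}). Equivalently, with A' the 2r×2r matrix with block form (2A, I_r; I_r, I_r), B' = (2B; 1/2,…,1/2) ∈ ℝ^{2r}, C' = 2C + r/24, one has F_{A',B',C'}(q) = q^{r/24}·((q²;q²)_∞/(q;q)_∞)^r·F_{A,B,C}(q²) for every C ∈ ℝ. -/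

import Mathlib

open Real

/-- The `q`-Pochhammer symbol `(q;q)_n = ∏_{k=1}^n (1 - q^k)`. -/
noncomputable def qPoch (q : ℝ) (n : ℕ) : ℝ := ∏ k ∈ Finset.range n, (1 - q ^ (k + 1))

/-- The infinite `q`-Pochhammer symbol `(q;q)_∞ = ∏_{k=1}^∞ (1 - q^k)`. -/
noncomputable def qPochInf (q : ℝ) : ℝ := ∏' k : ℕ, (1 - q ^ (k + 1))

/-- The Nahm sum `F_{A,B,C}(q) = ∑_{n ∈ (ℤ_{≥0})^ι} q^{½nᵀAn + nᵀB + C} / ∏ᵢ (q)_{nᵢ}`. -/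
noncomputable def nahmSum {ι : Type*} [Fintype ι]
    (A : Matrix ι ι ℝ) (B : ι → ℝ) (C : ℝ) (q : ℝ) : ℝ :=
  ∑' n : ι → ℕ,
    q ^ ((1 / 2) * (∑ i, ∑ j, (n i : ℝ) * A i j * (n j : ℝ)) +
          (∑ i, (n i : ℝ) * B i) + C) / ∏ i, qPoch q (n i)

/-- The summand `q^{k(k+1)/2 + nk} / (q)_k`, as a product. -/
noncomputable def eulerTerm (q : ℝ) (n k : ℕ) : ℝ :=
  ∏ j ∈ Finset.range k, (q ^ (n + j + 1) / (1 - q ^ (j + 1)))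

lemma one_sub_pow_pos' {q : ℝ} (h0 : 0 < q) (h1 : q < 1) (k : ℕ) : 0 < 1 - q ^ (k + 1) := by
  have := pow_lt_one₀ h0.le h1 (Nat.succ_ne_zero k)
  simpa using this

lemma qPoch_pos {q : ℝ} (h0 : 0 < q) (h1 : q < 1) (n : ℕ) : 0 < qPoch q n :=
  Finset.prod_pos fun k _ => one_sub_pow_pos' h0 h1 k

lemma eulerTerm_pos {q : ℝ} (h0 : 0 < q) (h1 : q < 1) (n k : ℕ) : 0 < eulerTerm q n k :=
  Finset.prod_pos fun j _ => div_pos (pow_pos h0 _) (one_sub_pow_pos' h0 h1 j)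

lemma eulerTerm_succ (q : ℝ) (n k : ℕ) :
    eulerTerm q n (k + 1) = eulerTerm q n k * (q ^ (n + k + 1) / (1 - q ^ (k + 1))) := by
  rw [eulerTerm, Finset.prod_range_succ, ← eulerTerm]

lemma eulerTerm_zero (q : ℝ) (n : ℕ) : eulerTerm q n 0 = 1 := by
  simp [eulerTerm]

lemma eulerTerm_shift (q : ℝ) (n k : ℕ) :
    eulerTerm q (n + 1) k = q ^ k * eulerTerm q n k := by
  induction k with
  | zero => simp [eulerTerm_zero]
  | succ k ih => rw [eulerTerm_succ, eulerTerm_succ, ih]; ring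

lemma eulerTerm_eq_rpow {q : ℝ} (h0 : 0 < q) (n k : ℕ) :
    eulerTerm q n k =
      q ^ ((1 / 2) * (k : ℝ) ^ 2 + (n : ℝ) * (k : ℝ) + (1 / 2) * (k : ℝ)) / qPoch q k := by
  induction k with
  | zero => simp [eulerTerm_zero, qPoch]
  | succ k ih =>
    rw [eulerTerm_succ, ih, qPoch, qPoch, Finset.prod_range_succ, div_mul_div_comm]
    congr 1
    rw [← Real.rpow_natCast q (n + k + 1), ← Real.rpow_add h0]
    congr 1
    push_cast
    ring

lemma summable_eulerTerm {q : ℝ} (h0 : 0 < q) (h1 : q < 1) (n : ℕ) :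
    Summable (eulerTerm q n) := by
  have hp : Filter.Tendsto (fun k : ℕ => q ^ (k + 1)) Filter.atTop (nhds 0) :=
    (tendsto_pow_atTop_nhds_zero_of_lt_one h0.le h1).comp (Filter.tendsto_add_atTop_nat 1)
  refine summable_of_ratio_test_tendsto_lt_one (l := 0) one_pos
    (Filter.Eventually.of_forall fun k => (eulerTerm_pos h0 h1 n k).ne') ?_
  have : Filter.Tendsto (fun k : ℕ => q ^ n * q ^ (k + 1) / (1 - q ^ (k + 1))) Filter.atTop
      (nhds (q ^ n * 0 / (1 - 0))) :=
    (hp.const_mul _).div (hp.const_sub 1) (by norm_num)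
  simp only [mul_zero, zero_div] at this
  refine this.congr fun k => ?_
  have h := eulerTerm_pos h0 h1 n k
  rw [Real.norm_of_nonneg h.le, Real.norm_of_nonneg (eulerTerm_pos h0 h1 n (k + 1)).le,
    eulerTerm_succ]
  rw [mul_div_assoc, mul_div_cancel_left₀ _ h.ne', ← mul_div_assoc, ← pow_add, add_assoc]

/-- The Euler sum `∑ₖ q^{k(k+1)/2 + nk} / (q)_k`. -/
noncomputable def eulerSum (q : ℝ) (n : ℕ) : ℝ := ∑' k, eulerTerm q n k

lemma eulerSum_step {q : ℝ} (h0 : 0 < q) (h1 : q < 1) (n : ℕ) :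
    eulerSum q n = (1 + q ^ (n + 1)) * eulerSum q (n + 1) := by
  have hs := summable_eulerTerm h0 h1
  have key : ∀ k, eulerTerm q n (k + 1) =
      eulerTerm q (n + 1) (k + 1) + q ^ (n + 1) * eulerTerm q (n + 1) k := by
    intro k
    have := (one_sub_pow_pos' h0 h1 k).ne'
    rw [eulerTerm_shift, eulerTerm_shift, eulerTerm_succ]
    field_simp
    ring
  have e1 : eulerSum q n = 1 + ∑' k, eulerTerm q n (k + 1) := by
    rw [eulerSum, (hs n).tsum_eq_zero_add, eulerTerm_zero]
  have e2 : eulerSum q (n + 1) = 1 + ∑' k, eulerTerm q (n + 1) (k + 1) := by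
    rw [eulerSum, (hs (n + 1)).tsum_eq_zero_add, eulerTerm_zero]
  have e3 : ∑' k, eulerTerm q n (k + 1) =
      (∑' k, eulerTerm q (n + 1) (k + 1)) + q ^ (n + 1) * eulerSum q (n + 1) := by
    simp_rw [key]
    rw [Summable.tsum_add ((summable_nat_add_iff 1).2 (hs (n + 1)))
      ((hs (n + 1)).mul_left _), tsum_mul_left, eulerSum]
  rw [e1, e3]
  linear_combination e2 * (-1)

lemma qPoch_sq (q : ℝ) (n : ℕ) :
    qPoch (q ^ 2) n = qPoch q n * ∏ j ∈ Finset.range n, (1 + q ^ (j + 1)) := by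
  rw [qPoch, qPoch, ← Finset.prod_mul_distrib]
  refine Finset.prod_congr rfl fun j _ => ?_
  ring

lemma eulerSum_zero {q : ℝ} (h0 : 0 < q) (h1 : q < 1) (n : ℕ) :
    eulerSum q 0 * qPoch q n = qPoch (q ^ 2) n * eulerSum q n := by
  induction n with
  | zero => simp [qPoch]
  | succ n ih =>
    have e1 : qPoch q (n + 1) = qPoch q n * (1 - q ^ (n + 1)) := by
      simp [qPoch, Finset.prod_range_succ]
    have e2 : qPoch (q ^ 2) (n + 1) = qPoch (q ^ 2) n * (1 - (q ^ 2) ^ (n + 1)) := by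
      simp [qPoch, Finset.prod_range_succ]
    rw [e1, e2, ← mul_assoc, ih, eulerSum_step h0 h1 n]
    ring

lemma tendsto_eulerSum {q : ℝ} (h0 : 0 < q) (h1 : q < 1) :
    Filter.Tendsto (eulerSum q) Filter.atTop (nhds 1) := by
  have hs := summable_eulerTerm h0 h1
  have hs' := fun n => (summable_nat_add_iff 1).2 (hs n)
  have e1 : ∀ n, eulerSum q n = 1 + ∑' k, eulerTerm q n (k + 1) := fun n => by
    rw [eulerSum, (hs n).tsum_eq_zero_add, eulerTerm_zero]
  have hb : ∀ n k, eulerTerm q n (k + 1) ≤ q ^ n * eulerTerm q 0 (k + 1) := by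
    intro n k
    induction n with
    | zero => simp
    | succ n ih =>
      rw [eulerTerm_shift, pow_succ' q n, mul_assoc]
      refine mul_le_mul ?_ ih (eulerTerm_pos h0 h1 _ _).le h0.le
      exact pow_le_of_le_one h0.le h1.le (Nat.succ_ne_zero k)
  have hlim : Filter.Tendsto (fun n => 1 + q ^ n * ∑' k, eulerTerm q 0 (k + 1)) Filter.atTop
      (nhds (1 + 0 * ∑' k, eulerTerm q 0 (k + 1))) :=
    ((tendsto_pow_atTop_nhds_zero_of_lt_one h0.le h1).mul_const _).const_add 1
  rw [zero_mul, add_zero] at hlim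
  refine tendsto_of_tendsto_of_tendsto_of_le_of_le tendsto_const_nhds hlim ?_ ?_
  · intro n
    have : 0 ≤ ∑' k, eulerTerm q n (k + 1) := tsum_nonneg fun k => (eulerTerm_pos h0 h1 _ _).le
    simp only [e1]
    linarith
  · intro n
    have := (hs' n).tsum_le_tsum (hb n) ((hs' 0).mul_left _)
    rw [tsum_mul_left] at this
    simp only [e1]
    linarith

lemma summable_neg_pow {q : ℝ} (h0 : 0 < q) (h1 : q < 1) :
    Summable fun k : ℕ => ‖-q ^ (k + 1)‖ := by
  have := (summable_nat_add_iff 1).2 (summable_geometric_of_lt_one h0.le h1)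
  refine this.congr fun k => ?_
  rw [norm_neg, Real.norm_of_nonneg (pow_pos h0 _).le]

lemma tendsto_qPoch {q : ℝ} (h0 : 0 < q) (h1 : q < 1) :
    Filter.Tendsto (qPoch q) Filter.atTop (nhds (qPochInf q)) := by
  have hm := multipliable_one_add_of_summable (summable_neg_pow h0 h1)
  have := hm.hasProd.tendsto_prod_nat
  simp only [← sub_eq_add_neg] at this
  exact this

lemma qPochInf_ne_zero {q : ℝ} (h0 : 0 < q) (h1 : q < 1) : qPochInf q ≠ 0 := by
  have := tprod_one_add_ne_zero_of_summable (f := fun k : ℕ => -q ^ (k + 1))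
    (fun k => by rw [← sub_eq_add_neg]; exact (one_sub_pow_pos' h0 h1 k).ne')
    (summable_neg_pow h0 h1)
  simp only [← sub_eq_add_neg] at this
  exact this

lemma eulerSum_eq {q : ℝ} (h0 : 0 < q) (h1 : q < 1) (n : ℕ) :
    eulerSum q n = qPochInf (q ^ 2) / qPochInf q * (qPoch q n / qPoch (q ^ 2) n) := by
  have h02 : 0 < q ^ 2 := by positivity
  have h12 : q ^ 2 < 1 := pow_lt_one₀ h0.le h1 two_ne_zero
  have hz : eulerSum q 0 = qPochInf (q ^ 2) / qPochInf q := by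
    rw [eq_div_iff (qPochInf_ne_zero h0 h1)]
    refine tendsto_nhds_unique ((tendsto_qPoch h0 h1).const_mul (eulerSum q 0)) ?_
    have := (tendsto_qPoch h02 h12).mul (tendsto_eulerSum h0 h1)
    rw [mul_one] at this
    exact this.congr fun n => (eulerSum_zero h0 h1 n).symm
  rw [← hz, ← mul_div_assoc, eulerSum_zero h0 h1,
    mul_div_cancel_left₀ _ (qPoch_pos h02 h12 n).ne']

lemma hasSum_of_eq {α : Type*} {f g : α → ℝ} {a b : ℝ} (h : HasSum f a)
    (hfg : ∀ x, g x = f x) (hab : b = a) : HasSum g b := by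
  have : g = f := funext hfg
  rw [this, hab]
  exact h

lemma hasSum_pi_prod {r : ℕ} (f : Fin r → ℕ → ℝ) (s : Fin r → ℝ)
    (hf : ∀ i k, 0 ≤ f i k) (hs : ∀ i, HasSum (f i) (s i)) :
    HasSum (fun k : Fin r → ℕ => ∏ i, f i (k i)) (∏ i, s i) := by
  induction r with
  | zero => simpa using hasSum_unique (fun k : Fin 0 → ℕ => (1 : ℝ))
  | succ r ih =>
    have h := ih (fun i => f i.succ) (fun i => s i.succ) (fun i => hf i.succ) (fun i => hs i.succ)
    have hsm := (hs 0).summable.mul_of_nonneg h.summable (hf 0)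
      (fun k => Finset.prod_nonneg fun i _ => hf _ _)
    have hm := (hs 0).mul h hsm
    rw [Fin.prod_univ_succ]
    rw [← (Fin.consEquiv (fun _ : Fin (r + 1) => ℕ)).hasSum_iff]
    refine hasSum_of_eq hm (fun p => ?_) rfl
    simp [Fin.prod_univ_succ, Fin.consEquiv]

lemma tsum_prod_of_fibers {α β : Type*} {f : α × β → ℝ} (hf : ∀ p, 0 ≤ f p) {g : α → ℝ}
    (hg : ∀ a, HasSum (fun b => f (a, b)) (g a)) : ∑' p, f p = ∑' a, g a := by
  have hg' : g = fun a => ∑' b, f (a, b) := funext fun a => (hg a).tsum_eq.symm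
  by_cases h : Summable f
  · rw [h.tsum_prod' fun a => (hg a).summable, hg']
  · rw [tsum_eq_zero_of_not_summable h, tsum_eq_zero_of_not_summable]
    intro h2
    refine h ((summable_prod_of_nonneg hf).2 ⟨fun a => (hg a).summable, ?_⟩)
    rwa [← hg']

lemma nahm_first {r : ℕ} (A : Matrix (Fin r) (Fin r) ℝ)
    (B : Fin r → ℝ) (q : ℝ) (hq : q ∈ Set.Ioo (0 : ℝ) 1) :
    (∑' p : (Fin r → ℕ) × (Fin r → ℕ),
        q ^ ((∑ i, ∑ j, (p.1 i : ℝ) * A i j * (p.1 j : ℝ)) +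
              (1 / 2) * (∑ i, ((p.2 i : ℝ)) ^ 2) +
              (∑ i, (p.1 i : ℝ) * (p.2 i : ℝ)) +
              2 * (∑ i, (p.1 i : ℝ) * B i) +
              (1 / 2) * (∑ i, (p.2 i : ℝ))) /
          ∏ i, (qPoch q (p.1 i) * qPoch q (p.2 i)) =
      (qPochInf (q ^ 2) / qPochInf q) ^ r *
        ∑' n : Fin r → ℕ,
          q ^ ((∑ i, ∑ j, (n i : ℝ) * A i j * (n j : ℝ)) + 2 * (∑ i, (n i : ℝ) * B i)) /
            ∏ i, qPoch (q ^ 2) (n i)) := by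
  obtain ⟨h0, h1⟩ := hq
  rw [← tsum_mul_left]
  apply tsum_prod_of_fibers
  · intro p
    exact div_nonneg (Real.rpow_nonneg h0.le _)
      (Finset.prod_nonneg fun i _ => (mul_pos (qPoch_pos h0 h1 _) (qPoch_pos h0 h1 _)).le)
  · intro n
    have h := hasSum_pi_prod (fun i k => eulerTerm q (n i) k) (fun i => eulerSum q (n i))
      (fun i k => (eulerTerm_pos h0 h1 _ _).le)
      (fun i => (summable_eulerTerm h0 h1 (n i)).hasSum)
    have h' := h.mul_left
      (q ^ ((∑ i, ∑ j, (n i : ℝ) * A i j * (n j : ℝ)) + 2 * (∑ i, (n i : ℝ) * B i)) /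
        ∏ i, qPoch q (n i))
    have hP : (∏ i, qPoch q (n i)) ≠ 0 :=
      (Finset.prod_pos fun i _ => qPoch_pos h0 h1 (n i)).ne'
    refine hasSum_of_eq h' (fun k => ?_) ?_
    · dsimp only
      simp only [eulerTerm_eq_rpow h0]
      rw [Finset.prod_div_distrib, Finset.prod_mul_distrib, div_mul_div_comm,
        ← Real.rpow_sum_of_pos h0, ← Real.rpow_add h0]
      congr 2
      simp only [Finset.sum_add_distrib, ← Finset.mul_sum]
      ring
    · have hP2 : (∏ i, qPoch (q ^ 2) (n i)) ≠ 0 :=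
        (Finset.prod_pos fun i _ => qPoch_pos (by positivity)
          (pow_lt_one₀ h0.le h1 two_ne_zero) (n i)).ne'
      simp only [eulerSum_eq h0 h1]
      rw [Finset.prod_mul_distrib, Finset.prod_const, Finset.card_univ, Fintype.card_fin,
        Finset.prod_div_distrib]
      field_simp

/-- For a positive definite symmetric `A`, `B ∈ ℝ^r` and `q ∈ (0,1)`:
`∑_{n,k ∈ (ℤ_{≥0})^r} q^{nᵀAn + ½kᵀk + nᵀk + 2nᵀB + ½(k₁+⋯+k_r)} / ∏ᵢ (q)_{nᵢ}(q)_{kᵢ}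
  = ((q²;q²)_∞/(q;q)_∞)^r ∑_{n} q^{nᵀAn + 2nᵀB} / ∏ᵢ (q²;q²)_{nᵢ}`;
equivalently, with `A' = (2A, I; I, I)`, `B' = (2B; ½,…,½)`, `C' = 2C + r/24`,
`F_{A',B',C'}(q) = q^{r/24}((q²;q²)_∞/(q;q)_∞)^r F_{A,B,C}(q²)`. -/
theorem nahmSum_doubling {r : ℕ} (hr : 1 ≤ r)
    (A : Matrix (Fin r) (Fin r) ℝ) (hA : A.PosDef) (hAs : A.IsSymm)
    (B : Fin r → ℝ) (q : ℝ) (hq : q ∈ Set.Ioo (0 : ℝ) 1) :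
    (∑' p : (Fin r → ℕ) × (Fin r → ℕ),
        q ^ ((∑ i, ∑ j, (p.1 i : ℝ) * A i j * (p.1 j : ℝ)) +
              (1 / 2) * (∑ i, ((p.2 i : ℝ)) ^ 2) +
              (∑ i, (p.1 i : ℝ) * (p.2 i : ℝ)) +
              2 * (∑ i, (p.1 i : ℝ) * B i) +
              (1 / 2) * (∑ i, (p.2 i : ℝ))) /
          ∏ i, (qPoch q (p.1 i) * qPoch q (p.2 i)) =
      (qPochInf (q ^ 2) / qPochInf q) ^ r *
        ∑' n : Fin r → ℕ,
          q ^ ((∑ i, ∑ j, (n i : ℝ) * A i j * (n j : ℝ)) + 2 * (∑ i, (n i : ℝ) * B i)) /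
            ∏ i, qPoch (q ^ 2) (n i)) ∧
    ∀ C : ℝ,
      nahmSum (Matrix.fromBlocks ((2 : ℝ) • A) (1 : Matrix (Fin r) (Fin r) ℝ)
            (1 : Matrix (Fin r) (Fin r) ℝ) (1 : Matrix (Fin r) (Fin r) ℝ))
          (Sum.elim (fun i => 2 * B i) (fun _ => (1 / 2 : ℝ))) (2 * C + r / 24) q =
        q ^ ((r : ℝ) / 24) * (qPochInf (q ^ 2) / qPochInf q) ^ r * nahmSum A B C (q ^ 2) := by
  refine ⟨nahm_first A B q hq, fun C => ?_⟩
  have h0 : 0 < q := hq.1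
  have e : nahmSum A B C (q ^ 2) = q ^ (2 * C) * ∑' n : Fin r → ℕ,
          q ^ ((∑ i, ∑ j, (n i : ℝ) * A i j * (n j : ℝ)) + 2 * (∑ i, (n i : ℝ) * B i)) /
            ∏ i, qPoch (q ^ 2) (n i) := by
    rw [nahmSum, ← tsum_mul_left]
    refine tsum_congr fun n => ?_
    rw [← mul_div_assoc, ← Real.rpow_add h0, ← Real.rpow_natCast q 2, ← Real.rpow_mul h0.le]
    congr 2
    push_cast
    ring
  have hf := nahm_first A B q hq
  rw [e, show ∀ a b c d : ℝ, a * b * (c * d) = c * a * (b * d) by intros; ring, ← hf,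
    ← Real.rpow_add h0, nahmSum,
    ← (Equiv.sumArrowEquivProdArrow (Fin r) (Fin r) ℕ).symm.tsum_eq, ← tsum_mul_left]
  refine tsum_congr fun p => ?_
  rw [← mul_div_assoc, ← Real.rpow_add h0]
  obtain ⟨n, k⟩ := p
  simp only [Fintype.sum_sum_type, Fintype.prod_sum_type,
    Equiv.sumArrowEquivProdArrow_symm_apply_inl, Equiv.sumArrowEquivProdArrow_symm_apply_inr,
    Matrix.fromBlocks_apply₁₁, Matrix.fromBlocks_apply₁₂, Matrix.fromBlocks_apply₂₁,
    Matrix.fromBlocks_apply₂₂, Sum.elim_inl, Sum.elim_inr, Finset.prod_mul_distrib]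
  congr 2
  have a1 : ∑ i, ∑ j, (n i : ℝ) * ((2 : ℝ) • A) i j * (n j : ℝ) =
      2 * ∑ i, ∑ j, (n i : ℝ) * A i j * (n j : ℝ) := by
    simp only [Finset.mul_sum, Matrix.smul_apply, smul_eq_mul]
    refine Finset.sum_congr rfl fun i _ => Finset.sum_congr rfl fun j _ => ?_
    ring
  have a2 : ∀ u v : Fin r → ℕ,
      ∑ i, ∑ j, (u i : ℝ) * (1 : Matrix (Fin r) (Fin r) ℝ) i j * (v j : ℝ) =
        ∑ i, (u i : ℝ) * (v i : ℝ) := by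
    intro u v
    simp [Matrix.one_apply]
  have a3 : ∑ i, (n i : ℝ) * (2 * B i) = 2 * ∑ i, (n i : ℝ) * B i := by
    rw [Finset.mul_sum]
    refine Finset.sum_congr rfl fun i _ => ?_
    ring
  have a4 : ∑ i, (k i : ℝ) * (n i : ℝ) = ∑ i, (n i : ℝ) * (k i : ℝ) :=
    Finset.sum_congr rfl fun i _ => mul_comm _ _
  have a5 : ∑ i, (k i : ℝ) * (k i : ℝ) = ∑ i, (k i : ℝ) ^ 2 :=
    Finset.sum_congr rfl fun i _ => (sq _).symm
  simp only [Finset.sum_add_distrib, a1, a2, a3, a4, a5, ← Finset.sum_mul]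
  ring
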